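/- Let ψ(x) = Σ_{n ≤ x} Λ(n) be the Chebyshev function, where the sum runs over positive integers n ≤ x. Then ψ(x) ~ x as x → ∞, i.e. ψ(x)/x → 1. (This is the prime number theorem in the form ψ(x) = x + o(x).) -/

import Mathlib

open Filter Real Finset ArithmeticFunction

open scoped FourierTransform Topology
open MeasureTheory

section Tauberian

variable {f : ℝ → ℂ} {G : ℂ → ℂ} {χ : ℝ → ℂ} {M : ℝ}

lemma integrable_mul_cexp_neg (hfm : Measurable f) (hM : ∀ u, ‖f u‖ ≤ M)
    (hf0 : ∀ u ≤ 0, f u = 0) {s : ℂ} (hs : 0 < s.re) :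
    Integrable fun u : ℝ ↦ f u * Complex.exp (-s * u) := by
  have h1 : IntegrableOn (fun u : ℝ ↦ M * Real.exp (-s.re * u)) (Set.Ioi 0) :=
    (integrableOn_exp_mul_Ioi (by linarith) 0).const_mul M
  refine (h1.integrable_indicator measurableSet_Ioi).mono' (by fun_prop) (.of_forall fun u ↦ ?_)
  rcases le_or_gt u 0 with hu | hu
  · simp [hf0 u hu, hu]
  · rw [Set.indicator_of_mem (Set.mem_Ioi.2 hu), norm_mul, Complex.norm_exp]
    simpa using mul_le_mul_of_nonneg_right (hM u) (Real.exp_nonneg (-(s.re * u)))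

lemma integral_mul_cexp_mul_fourier (hfm : Measurable f) (hM : ∀ u, ‖f u‖ ≤ M)
    (hf0 : ∀ u ≤ 0, f u = 0)
    (hG : ∀ s : ℂ, 0 < s.re → ∫ u : ℝ, f u * Complex.exp (-s * u) = G s)
    (hχ : Integrable χ) {ε : ℝ} (hε : 0 < ε) (R y : ℝ) :
    ∫ u : ℝ, f u * Complex.exp (-ε * u) * 𝓕 χ (R * (u - y)) =
      ∫ t : ℝ, Complex.exp ((2 * π * t * R * y : ℝ) * Complex.I) * χ t *
        G (ε + (2 * π * R * t : ℝ) * Complex.I) := by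
  have hint : Integrable (Function.uncurry fun u t : ℝ ↦
      Complex.exp ((-2 * π * t * (R * (u - y)) : ℝ) * Complex.I) *
        ((f u * Complex.exp (-ε * u)) * χ t)) (volume.prod volume) := by
    refine ((integrable_mul_cexp_neg (s := ε) hfm hM hf0 (by simpa using hε)).mul_prod hχ).bdd_mul (c := 1)
      (by fun_prop) (.of_forall fun p ↦ ?_)
    rw [Complex.norm_exp_ofReal_mul_I]
  calc
    _ = ∫ u : ℝ, ∫ t : ℝ, Complex.exp ((-2 * π * t * (R * (u - y)) : ℝ) * Complex.I) *
        ((f u * Complex.exp (-ε * u)) * χ t) := by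
      refine integral_congr_ae (.of_forall fun u ↦ ?_)
      simp only [Real.fourier_real_eq_integral_exp_smul, ← integral_const_mul, smul_eq_mul]
      refine integral_congr_ae (.of_forall fun t ↦ ?_)
      ring
    _ = _ := by
      rw [integral_integral_swap hint]
      refine integral_congr_ae (.of_forall fun t ↦ ?_)
      simp only
      rw [← hG _ (by simpa using hε), ← integral_const_mul]
      refine integral_congr_ae (.of_forall fun u ↦ ?_)
      have : Complex.exp ((-2 * π * t * (R * (u - y)) : ℝ) * Complex.I) * Complex.exp (-ε * u) =
          Complex.exp ((2 * π * t * R * y : ℝ) * Complex.I) *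
          Complex.exp (-(ε + (2 * π * R * t : ℝ) * Complex.I) * u) := by
        rw [← Complex.exp_add, ← Complex.exp_add]
        congr 1
        push_cast
        ring
      linear_combination (f u * χ t) * this

lemma integral_mul_fourier (hfm : Measurable f) (hM : ∀ u, ‖f u‖ ≤ M)
    (hf0 : ∀ u ≤ 0, f u = 0)
    (hG : ∀ s : ℂ, 0 < s.re → ∫ u : ℝ, f u * Complex.exp (-s * u) = G s)
    (hGc : ContinuousOn G {s | 0 ≤ s.re})
    (hχ : Continuous χ) (hχs : HasCompactSupport χ) (hK : Integrable (𝓕 χ))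
    {R : ℝ} (hR : 0 < R) (y : ℝ) :
    ∫ u : ℝ, f u * 𝓕 χ (R * (u - y)) =
      ∫ t : ℝ, Complex.exp ((2 * π * t * R * y : ℝ) * Complex.I) * χ t *
        G ((2 * π * R * t : ℝ) * Complex.I) := by
  have hχi : Integrable χ := hχ.integrable_of_hasCompactSupport hχs
  have hKR : Integrable fun u : ℝ ↦ 𝓕 χ (R * (u - y)) :=
    (hK.comp_mul_left' hR.ne').comp_sub_right y
  have hpos : ∀ᶠ ε : ℝ in 𝓝[>] 0, 0 < ε ∧ ε ≤ 1 := by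
    filter_upwards [Ioc_mem_nhdsGT (zero_lt_one (α := ℝ))] with ε h using h
  have hleft : Tendsto (fun ε : ℝ ↦ ∫ u : ℝ, f u * Complex.exp (-ε * u) * 𝓕 χ (R * (u - y)))
      (𝓝[>] 0) (𝓝 (∫ u : ℝ, f u * 𝓕 χ (R * (u - y)))) := by
    refine tendsto_integral_filter_of_dominated_convergence
      (fun u ↦ M * ‖𝓕 χ (R * (u - y))‖) ?_ ?_ (hKR.norm.const_mul M) ?_
    · exact .of_forall fun ε ↦ (by fun_prop : Measurable fun u : ℝ ↦
        f u * Complex.exp (-ε * u)).aestronglyMeasurable.mul hKR.aestronglyMeasurable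
    · filter_upwards [hpos] with ε hε
      refine .of_forall fun u ↦ ?_
      rw [norm_mul]
      gcongr
      rcases le_or_gt u 0 with hu | hu
      · simpa [hf0 u hu] using (norm_nonneg _).trans (hM u)
      · rw [norm_mul, Complex.norm_exp]
        have : Real.exp ((-(ε : ℂ) * u).re) ≤ 1 := by
          simpa using mul_nonneg hε.1.le hu.le
        exact (mul_le_of_le_one_right (norm_nonneg _) this).trans (hM u)
    · refine .of_forall fun u ↦ Tendsto.mono_left ?_ nhdsWithin_le_nhds
      have : Continuous fun ε : ℝ ↦ f u * Complex.exp (-ε * u) * 𝓕 χ (R * (u - y)) := by fun_prop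
      simpa using this.tendsto 0
  obtain ⟨C, hC⟩ : ∃ C, ∀ p ∈ Set.Icc (0 : ℝ) 1 ×ˢ tsupport χ,
      ‖G (p.1 + (2 * π * R * p.2 : ℝ) * Complex.I)‖ ≤ C := by
    refine (isCompact_Icc.prod hχs).exists_bound_of_continuousOn
      (hGc.comp (by fun_prop) fun p hp ↦ ?_)
    simpa using hp.1.1
  have hGline (ε : ℝ) (hε : 0 ≤ ε) :
      Continuous fun t : ℝ ↦ G (ε + (2 * π * R * t : ℝ) * Complex.I) :=
    hGc.comp_continuous (by fun_prop) fun t ↦ by simpa using hε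
  have hright : Tendsto (fun ε : ℝ ↦ ∫ t : ℝ,
      Complex.exp ((2 * π * t * R * y : ℝ) * Complex.I) * χ t *
        G (ε + (2 * π * R * t : ℝ) * Complex.I)) (𝓝[>] 0)
      (𝓝 (∫ t : ℝ, Complex.exp ((2 * π * t * R * y : ℝ) * Complex.I) * χ t *
        G ((2 * π * R * t : ℝ) * Complex.I))) := by
    refine tendsto_integral_filter_of_dominated_convergence
      (fun t ↦ ‖χ t‖ * C) ?_ ?_ (hχi.norm.mul_const C) ?_
    · filter_upwards [hpos] with ε hε
      exact (Continuous.mul (by fun_prop) (hGline ε hε.1.le)).aestronglyMeasurable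
    · filter_upwards [hpos] with ε hε
      refine .of_forall fun t ↦ ?_
      by_cases ht : t ∈ tsupport χ
      · rw [norm_mul, norm_mul, Complex.norm_exp_ofReal_mul_I, one_mul]
        gcongr
        exact hC (ε, t) ⟨⟨hε.1.le, hε.2⟩, ht⟩
      · simp [image_eq_zero_of_notMem_tsupport ht]
    · refine .of_forall fun t ↦ ?_
      refine tendsto_const_nhds.mul ?_
      have h0 := hGc ((2 * π * R * t : ℝ) * Complex.I) (by simp)
      refine h0.tendsto.comp (tendsto_nhdsWithin_iff.2 ⟨?_, ?_⟩)
      · have : Continuous fun ε : ℝ ↦ (ε + (2 * π * R * t : ℝ) * Complex.I) := by fun_prop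
        simpa using (this.tendsto 0).mono_left nhdsWithin_le_nhds
      · filter_upwards [hpos] with ε hε
        simpa using hε.1.le
  refine tendsto_nhds_unique hleft (hright.congr' ?_)
  filter_upwards [hpos] with ε hε
  exact (integral_mul_cexp_mul_fourier hfm hM hf0 hG hχi hε.1 R y).symm

lemma tendsto_integral_comp_add_div_mul_fourier (hfm : Measurable f) (hM : ∀ u, ‖f u‖ ≤ M)
    (hf0 : ∀ u ≤ 0, f u = 0)
    (hG : ∀ s : ℂ, 0 < s.re → ∫ u : ℝ, f u * Complex.exp (-s * u) = G s)
    (hGc : ContinuousOn G {s | 0 ≤ s.re})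
    (hχ : Continuous χ) (hχs : HasCompactSupport χ) (hK : Integrable (𝓕 χ))
    {R : ℝ} (hR : 0 < R) :
    Tendsto (fun y : ℝ ↦ ∫ w : ℝ, f (y + w / R) * 𝓕 χ w) atTop (𝓝 0) := by
  have hRL := Real.tendsto_integral_exp_smul_cocompact
    fun t : ℝ ↦ χ t * G ((2 * π * R * t : ℝ) * Complex.I)
  have hw : Tendsto (fun y : ℝ ↦ -(R * y)) atTop (cocompact ℝ) :=
    (tendsto_neg_atTop_atBot.comp (tendsto_id.const_mul_atTop hR)).mono_right
      atBot_le_cocompact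
  have h := (hRL.comp hw).const_mul (R : ℂ)
  rw [mul_zero] at h
  refine h.congr fun y ↦ ?_
  have h1 : ∫ t : ℝ, 𝐞 (-(t * -(R * y))) • (χ t * G ((2 * π * R * t : ℝ) * Complex.I)) =
      ∫ u : ℝ, f u * 𝓕 χ (R * (u - y)) := by
    rw [integral_mul_fourier hfm hM hf0 hG hGc hχ hχs hK hR y]
    refine integral_congr_ae (.of_forall fun t ↦ ?_)
    simp only [Circle.smul_def, Real.fourierChar_apply, smul_eq_mul, mul_assoc]
    congr 3
    push_cast
    ring
  have h2 : ∫ u : ℝ, f u * 𝓕 χ (R * (u - y)) =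
      ∫ v : ℝ, f (y + (R * v) / R) * 𝓕 χ (R * v) := by
    rw [← integral_add_right_eq_self _ y]
    refine integral_congr_ae (.of_forall fun t ↦ ?_)
    simp only [add_sub_cancel_right, mul_div_cancel_left₀ _ hR.ne', add_comm y]
  simp only [Function.comp_apply]
  rw [h1, h2, Measure.integral_comp_mul_left (fun w ↦ f (y + w / R) * 𝓕 χ w) R,
    abs_of_pos (inv_pos.2 hR), Complex.real_smul, Complex.ofReal_inv,
    mul_inv_cancel_left₀ (by exact_mod_cast hR.ne')]


lemma norm_intervalIntegral_add_sub_le (hfm : Measurable f) (hM : ∀ u, ‖f u‖ ≤ M)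
    (a b h : ℝ) :
    ‖(∫ u in (a + h)..(b + h), f u) - ∫ u in a..b, f u‖ ≤ 2 * M * |h| := by
  have hi (c d : ℝ) : IntervalIntegrable f volume c d :=
    (intervalIntegrable_const (c := M)).mono_fun' hfm.aestronglyMeasurable (.of_forall hM)
  have hb (c : ℝ) : ‖∫ u in c..(c + h), f u‖ ≤ M * |h| := by
    simpa using intervalIntegral.norm_integral_le_of_norm_le_const
      (a := c) (b := c + h) fun u _ ↦ hM u
  have : (∫ u in (a + h)..(b + h), f u) - ∫ u in a..b, f u =
      (∫ u in b..(b + h), f u) - ∫ u in a..(a + h), f u :=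
    intervalIntegral.integral_interval_sub_interval_comm' (hi _ _) (hi _ _) (hi _ _)
  rw [this]
  linarith [norm_sub_le (∫ u in b..(b + h), f u) (∫ u in a..(a + h), f u), hb a, hb b]

lemma norm_intervalIntegral_le_of_integral_kernel {K : ℝ → ℂ}
    (hfm : Measurable f) (hM : ∀ u, ‖f u‖ ≤ M)
    (hK : Integrable K) (hK' : Integrable fun w ↦ |w| * ‖K w‖) (hK1 : ∫ w, K w = 1)
    {R δ : ℝ} (hR : 0 < R) (hδ : 0 ≤ δ) (y : ℝ) :
    ‖∫ u in y..(y + δ), f u‖ ≤ ‖∫ v in (0 : ℝ)..δ, ∫ w : ℝ, f (y + v + w / R) * K w‖ +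
      2 * M / R * ∫ w : ℝ, |w| * ‖K w‖ := by
  have hint : Integrable (Function.uncurry fun v w : ℝ ↦ f (y + v + w / R) * K w)
      ((volume.restrict (Set.Ioc 0 δ)).prod volume) := by
    refine ((integrable_const (1 : ℂ)).mul_prod hK).bdd_mul (c := M)
      (f := fun p : ℝ × ℝ ↦ f (y + p.1 + p.2 / R))
      (by fun_prop : Measurable fun p : ℝ × ℝ ↦ f (y + p.1 + p.2 / R)).aestronglyMeasurable
      (.of_forall fun p ↦ hM _) |>.congr ?_
    exact .of_forall fun p ↦ by simp [Function.uncurry]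
  have hshift (w : ℝ) : ∫ v in Set.Ioc 0 δ, f (y + v + w / R) * K w =
      (∫ u in (y + w / R)..(y + δ + w / R), f u) * K w := by
    rw [integral_mul_const, ← intervalIntegral.integral_of_le hδ]
    congr 1
    simp_rw [add_right_comm y _ (w / R)]
    simp
  have hswap : ∫ v in (0 : ℝ)..δ, ∫ w : ℝ, f (y + v + w / R) * K w =
      ∫ w : ℝ, (∫ u in (y + w / R)..(y + δ + w / R), f u) * K w := by
    rw [intervalIntegral.integral_of_le hδ, integral_integral_swap hint]
    exact integral_congr_ae (.of_forall hshift)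
  have hi1 : Integrable fun w : ℝ ↦ (∫ u in (y + w / R)..(y + δ + w / R), f u) * K w :=
    hint.integral_prod_right.congr (.of_forall hshift)
  have hdiff : ‖(∫ w : ℝ, (∫ u in (y + w / R)..(y + δ + w / R), f u) * K w) -
      ∫ u in y..(y + δ), f u‖ ≤ 2 * M / R * ∫ w : ℝ, |w| * ‖K w‖ := by
    have h1 : ∫ u in y..(y + δ), f u = ∫ w : ℝ, (∫ u in y..(y + δ), f u) * K w := by
      rw [integral_const_mul, hK1, mul_one]
    rw [h1, ← integral_sub hi1 (hK.const_mul _), ← integral_const_mul]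
    refine norm_integral_le_of_norm_le (hK'.const_mul _) (.of_forall fun w ↦ ?_)
    rw [← sub_mul, norm_mul]
    calc
      _ ≤ 2 * M * |w / R| * ‖K w‖ := by
        gcongr
        exact norm_intervalIntegral_add_sub_le hfm hM y (y + δ) (w / R)
      _ = _ := by
        rw [abs_div, abs_of_pos hR]
        ring
  rw [hswap]
  have := norm_sub_le (∫ w : ℝ, (∫ u in (y + w / R)..(y + δ + w / R), f u) * K w)
    ((∫ w : ℝ, (∫ u in (y + w / R)..(y + δ + w / R), f u) * K w) - ∫ u in y..(y + δ), f u)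
  rw [sub_sub_cancel] at this
  linarith

lemma exists_schwartzMap_hasCompactSupport_integral_fourier_eq_one :
    ∃ φ : SchwartzMap ℝ ℂ, HasCompactSupport φ ∧ ∫ w, 𝓕 φ w = 1 := by
  let b : ContDiffBump (0 : ℝ) := ⟨1, 2, one_pos, one_lt_two⟩
  have hs : HasCompactSupport fun x : ℝ ↦ (b x : ℂ) :=
    b.hasCompactSupport.comp_left (g := fun x : ℝ ↦ (x : ℂ)) (by simp)
  have hd : ContDiff ℝ (⊤ : ℕ∞) fun x : ℝ ↦ (b x : ℂ) :=
    Complex.ofRealCLM.contDiff.comp b.contDiff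
  refine ⟨hs.toSchwartzMap hd, hs, ?_⟩
  set φ := hs.toSchwartzMap hd
  have h : 𝓕⁻ (𝓕 φ) 0 = φ 0 := by rw [FourierTransform.fourierInv_fourier_eq]
  rw [SchwartzMap.fourierInv_coe, Real.fourierInv_eq'] at h
  simp only [inner_zero_right, mul_zero, Complex.ofReal_zero, zero_mul, Complex.exp_zero,
    one_smul] at h
  rw [h]
  have : b 0 = 1 := b.one_of_mem_closedBall (by simp [b])
  simp [φ, this]

/-- A Tauberian theorem of Wiener-Ikehara type: if the Laplace transform of a bounded function
extends continuously to the closed right half-plane, the integrals of the function over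
intervals of fixed length tend to zero. -/
theorem tendsto_intervalIntegral_of_laplace_continuousOn (hfm : Measurable f)
    (hM : ∀ u, ‖f u‖ ≤ M) (hf0 : ∀ u ≤ 0, f u = 0)
    (hG : ∀ s : ℂ, 0 < s.re → ∫ u : ℝ, f u * Complex.exp (-s * u) = G s)
    (hGc : ContinuousOn G {s | 0 ≤ s.re}) {δ : ℝ} (hδ : 0 < δ) :
    Tendsto (fun y : ℝ ↦ ∫ u in y..(y + δ), f u) atTop (𝓝 0) := by
  obtain ⟨φ, hφs, hφ1⟩ := exists_schwartzMap_hasCompactSupport_integral_fourier_eq_one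
  have hM0 : 0 ≤ M := (norm_nonneg _).trans (hM 0)
  have hK : Integrable (𝓕 (φ : ℝ → ℂ)) := by
    rw [← SchwartzMap.fourier_coe]
    exact (𝓕 φ).integrable
  have hK' : Integrable fun w : ℝ ↦ |w| * ‖𝓕 (φ : ℝ → ℂ) w‖ := by
    rw [← SchwartzMap.fourier_coe]
    have h := (𝓕 φ : SchwartzMap ℝ ℂ).integrable_pow_mul volume 1
    simpa only [pow_one, Real.norm_eq_abs] using h
  rw [SchwartzMap.fourier_coe] at hφ1
  set C := ∫ w : ℝ, |w| * ‖𝓕 (φ : ℝ → ℂ) w‖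
  have hC : 0 ≤ C := integral_nonneg fun w ↦ by positivity
  rw [Metric.tendsto_atTop]
  intro η hη
  set R := (4 * M * C + 1) / η with hRdef
  have hR : 0 < R := by positivity
  have hsmall : 2 * M / R * C ≤ η / 2 := by
    rw [hRdef, div_div_eq_mul_div, div_mul_eq_mul_div, div_le_div_iff₀ (by positivity) two_pos]
    nlinarith
  have hg := tendsto_integral_comp_add_div_mul_fourier hfm hM hf0 hG hGc φ.continuous hφs hK hR
  rw [Metric.tendsto_atTop] at hg
  obtain ⟨Y, hY⟩ := hg (η / (4 * δ)) (by positivity)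
  refine ⟨Y, fun y hy ↦ ?_⟩
  rw [dist_zero_right]
  have h1 : ‖∫ v in (0 : ℝ)..δ, ∫ w : ℝ, f (y + v + w / R) * 𝓕 (φ : ℝ → ℂ) w‖ ≤
      η / (4 * δ) * |δ - 0| := by
    refine intervalIntegral.norm_integral_le_of_norm_le_const fun v hv ↦ ?_
    rw [Set.uIoc_of_le hδ.le] at hv
    simpa using (hY (y + v) (by linarith [hv.1])).le
  have h2 : η / (4 * δ) * |δ - 0| = η / 4 := by
    rw [sub_zero, abs_of_pos hδ]
    field_simp
  linarith [norm_intervalIntegral_le_of_integral_kernel hfm hM hK hK' hφ1 hR hδ.le y]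

end Tauberian

section VonMangoldt

open Chebyshev

lemma psi_isBigO_natCast :
    (fun n : ℕ ↦ ∑ k ∈ Icc 1 n, Λ k) =O[atTop] fun n ↦ (n : ℝ) ^ (1 : ℝ) := by
  refine .of_bound (Real.log 4 + 4) (.of_forall fun n ↦ ?_)
  have h := psi_le_const_mul_self (Nat.cast_nonneg (α := ℝ) n)
  rw [psi, Nat.floor_natCast] at h
  have h0 : 0 ≤ ∑ k ∈ Icc 1 n, Λ k := sum_nonneg fun _ _ ↦ vonMangoldt_nonneg
  rw [Real.rpow_one, Real.norm_of_nonneg h0, Real.norm_of_nonneg n.cast_nonneg]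
  exact h

lemma integral_psi_exp_mul_cexp {s : ℂ} (hs : 0 < s.re) :
    ∫ u in Set.Ioi (0 : ℝ), ((psi (Real.exp u) * Real.exp (-u) : ℝ) : ℂ) * Complex.exp (-s * u) =
      LSeries (fun n ↦ (Λ n : ℂ)) (1 + s) / (1 + s) := by
  have hne : 1 + s ≠ 0 := fun h ↦ by
    have := congrArg Complex.re h
    simp at this
    linarith
  rw [LSeries_eq_mul_integral_of_nonneg _ zero_le_one (by simpa using hs) psi_isBigO_natCast
    fun _ ↦ vonMangoldt_nonneg, mul_div_cancel_left₀ _ hne]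
  have himg : Real.exp '' Set.Ioi 0 = Set.Ioi 1 := by
    ext x
    constructor
    · rintro ⟨u, hu, rfl⟩
      exact Real.one_lt_exp_iff.2 hu
    · intro hx
      exact ⟨Real.log x, Real.log_pos hx, Real.exp_log (zero_lt_one.trans hx)⟩
  rw [← himg, integral_image_eq_integral_abs_deriv_smul measurableSet_Ioi
    (fun u _ ↦ (Real.hasDerivAt_exp u).hasDerivWithinAt) Real.exp_injective.injOn]
  refine setIntegral_congr_fun measurableSet_Ioi fun u _ ↦ ?_
  have hsum : (∑ k ∈ Icc 1 ⌊Real.exp u⌋₊, (Λ k : ℂ)) = (psi (Real.exp u) : ℂ) := by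
    rw [psi, Complex.ofReal_sum]
    rfl
  have hexp : ((Real.exp u : ℝ) : ℂ) ^ (-(1 + s + 1)) =
      Complex.exp (-u) * Complex.exp (-u) * Complex.exp (-s * u) := by
    rw [Complex.cpow_def_of_ne_zero (by exact_mod_cast (Real.exp_pos u).ne'),
      ← Complex.ofReal_log (Real.exp_pos u).le, Real.log_exp, ← Complex.exp_add, ← Complex.exp_add]
    congr 1
    ring
  have hone : Complex.exp u * Complex.exp (-u) = 1 := by
    rw [← Complex.exp_add, add_neg_cancel, Complex.exp_zero]
  rw [hexp, hsum]
  simp only [abs_of_pos (Real.exp_pos u), Complex.real_smul, Complex.ofReal_mul,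
    Complex.ofReal_exp, Complex.ofReal_neg]
  linear_combination (-(psi (Real.exp u) : ℂ) * Complex.exp (-u) * Complex.exp (-s * u)) * hone

/-- The normalised error term `ψ(e^u) / e^u - 1` for `u > 0`. -/
noncomputable def psiError (u : ℝ) : ℝ :=
  (Set.Ioi 0).indicator (fun u ↦ psi (Real.exp u) * Real.exp (-u) - 1) u

lemma psi_exp_mul_exp_neg_mem_Icc (u : ℝ) :
    psi (Real.exp u) * Real.exp (-u) ∈ Set.Icc 0 (Real.log 4 + 4) := by
  refine ⟨mul_nonneg (psi_nonneg _) (Real.exp_nonneg _), ?_⟩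
  rw [Real.exp_neg, ← div_eq_mul_inv, div_le_iff₀ (Real.exp_pos u)]
  exact psi_le_const_mul_self (Real.exp_nonneg u)

lemma measurable_psi_exp_mul_exp_neg :
    Measurable fun u ↦ psi (Real.exp u) * Real.exp (-u) :=
  (psi_mono.measurable.comp Real.measurable_exp).mul (by fun_prop)

lemma norm_psi_exp_mul_exp_neg_le (u : ℝ) :
    ‖psi (Real.exp u) * Real.exp (-u)‖ ≤ Real.log 4 + 4 := by
  rw [Real.norm_of_nonneg (psi_exp_mul_exp_neg_mem_Icc u).1]
  exact (psi_exp_mul_exp_neg_mem_Icc u).2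

lemma intervalIntegrable_psi_exp (a b : ℝ) :
    IntervalIntegrable (fun u ↦ psi (Real.exp u) * Real.exp (-u)) volume a b :=
  (intervalIntegrable_const (c := Real.log 4 + 4)).mono_fun'
    measurable_psi_exp_mul_exp_neg.aestronglyMeasurable (.of_forall norm_psi_exp_mul_exp_neg_le)

lemma integral_psiError_mul_cexp {s : ℂ} (hs : 0 < s.re) :
    ∫ u : ℝ, (psiError u : ℂ) * Complex.exp (-s * u) =
      (vonMangoldt.LFunctionResidueClassAux (1 : ZMod 1) (1 + s) - 1) / (1 + s) := by
  have hne : 1 + s ≠ 0 := fun h ↦ by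
    have := congrArg Complex.re h
    simp at this
    linarith
  have hs0 : s ≠ 0 := fun h ↦ by simp [h] at hs
  have hL : vonMangoldt.LFunctionResidueClassAux (1 : ZMod 1) (1 + s) =
      LSeries (fun n ↦ (Λ n : ℂ)) (1 + s) - 1 / s := by
    rw [vonMangoldt.eqOn_LFunctionResidueClassAux isUnit_one
      (show 1 < (1 + s).re by simpa using hs)]
    have : vonMangoldt.residueClass (1 : ZMod 1) = fun n ↦ Λ n := by
      ext n
      simp [vonMangoldt.residueClass, Subsingleton.elim (n : ZMod 1) 1]
    simp [this]
  have hi : IntegrableOn (fun u : ℝ ↦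
      ((psi (Real.exp u) * Real.exp (-u) : ℝ) : ℂ) * Complex.exp (-s * u)) (Set.Ioi 0) := by
    have h := integrable_mul_cexp_neg (s := s) (M := Real.log 4 + 4)
      (f := (Set.Ioi 0).indicator fun u ↦ ((psi (Real.exp u) * Real.exp (-u) : ℝ) : ℂ))
      ((Complex.measurable_ofReal.comp measurable_psi_exp_mul_exp_neg).indicator measurableSet_Ioi)
      (fun u ↦ (norm_indicator_le_norm_self _ _).trans ?_)
      (fun u hu ↦ Set.indicator_of_notMem (by simpa using hu) _) hs
    · refine (h.integrableOn (s := Set.Ioi 0)).congr_fun (fun u hu ↦ ?_) measurableSet_Ioi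
      simp only [Set.indicator_of_mem hu]
    · rw [Complex.norm_real]
      exact norm_psi_exp_mul_exp_neg_le u
  have hexp : IntegrableOn (fun u : ℝ ↦ Complex.exp (-s * u)) (Set.Ioi 0) :=
    integrableOn_exp_mul_complex_Ioi (by simpa using hs) 0
  calc
    _ = ∫ u in Set.Ioi (0 : ℝ),
        (((psi (Real.exp u) * Real.exp (-u) : ℝ) : ℂ) * Complex.exp (-s * u) -
          Complex.exp (-s * u)) := by
      rw [← integral_indicator measurableSet_Ioi]
      refine integral_congr_ae (.of_forall fun u ↦ ?_)
      by_cases hu : u ∈ Set.Ioi (0 : ℝ)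
      · simp only [psiError, Set.indicator_of_mem hu]
        push_cast
        ring
      · simp only [psiError, Set.indicator_of_notMem hu, Complex.ofReal_zero, zero_mul]
    _ = _ := by
      rw [integral_sub hi hexp, integral_psi_exp_mul_cexp hs,
        integral_exp_mul_complex_Ioi (by simpa using hs) 0, hL]
      simp
      field_simp
      ring

lemma continuousOn_laplace_psiError :
    ContinuousOn (fun s ↦
      (vonMangoldt.LFunctionResidueClassAux (1 : ZMod 1) (1 + s) - 1) / (1 + s))
      {s | 0 ≤ s.re} := by
  refine ContinuousOn.div (ContinuousOn.sub ?_ continuousOn_const) (by fun_prop) fun s hs h ↦ ?_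
  · exact (vonMangoldt.continuousOn_LFunctionResidueClassAux (1 : ZMod 1)).comp
      (by fun_prop) fun s hs ↦ by simpa using hs
  · have := congrArg Complex.re h
    have hs' : 0 ≤ s.re := hs
    simp at this
    linarith

lemma tendsto_intervalIntegral_psiError {δ : ℝ} (hδ : 0 < δ) :
    Tendsto (fun y : ℝ ↦ ∫ u in y..(y + δ), psiError u) atTop (𝓝 0) := by
  have hm : Measurable psiError :=
    (measurable_psi_exp_mul_exp_neg.sub_const 1).indicator measurableSet_Ioi
  have h := tendsto_intervalIntegral_of_laplace_continuousOn (f := fun u ↦ (psiError u : ℂ))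
    (M := Real.log 4 + 5) (Complex.measurable_ofReal.comp hm) (fun u ↦ ?_)
    (fun u hu ↦ ?_) (fun s hs ↦ integral_psiError_mul_cexp hs) continuousOn_laplace_psiError hδ
  · simp_rw [intervalIntegral.integral_ofReal] at h
    exact ((Complex.continuous_re.tendsto _).comp h).congr fun y ↦ Complex.ofReal_re _
  · have := psi_exp_mul_exp_neg_mem_Icc u
    have h4 : 0 < Real.log 4 := Real.log_pos (by norm_num)
    rw [Complex.norm_real, psiError]
    refine (norm_indicator_le_norm_self _ _).trans ?_
    rw [Real.norm_eq_abs, abs_le]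
    constructor <;> linarith [this.1, this.2]
  · simp [psiError, hu]

lemma tendsto_intervalIntegral_psi_exp {δ : ℝ} (hδ : 0 < δ) :
    Tendsto (fun y : ℝ ↦ ∫ u in y..(y + δ), psi (Real.exp u) * Real.exp (-u)) atTop (𝓝 δ) := by
  have h := (tendsto_intervalIntegral_psiError hδ).add_const δ
  rw [zero_add] at h
  refine h.congr' ?_
  filter_upwards [eventually_ge_atTop 0] with y hy
  have hi := intervalIntegrable_psi_exp y (y + δ)
  have : ∫ u in y..(y + δ), psiError u =
      ∫ u in y..(y + δ), (psi (Real.exp u) * Real.exp (-u) - 1) := by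
    refine intervalIntegral.integral_congr_ae (.of_forall fun u hu ↦ ?_)
    rw [Set.uIoc_of_le (by linarith)] at hu
    exact Set.indicator_of_mem (show u ∈ Set.Ioi 0 from hy.trans_lt hu.1) _
  rw [this, intervalIntegral.integral_sub hi (by simp)]
  simp

lemma psi_exp_mul_exp_neg_le {u v : ℝ} (h : u ≤ v) :
    psi (Real.exp u) * Real.exp (-u) ≤
      Real.exp (v - u) * (psi (Real.exp v) * Real.exp (-v)) := by
  have h1 : psi (Real.exp u) ≤ psi (Real.exp v) := psi_mono (Real.exp_le_exp.2 h)
  have h2 : Real.exp (-u) = Real.exp (v - u) * Real.exp (-v) := by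
    rw [← Real.exp_add]
    ring_nf
  calc
    _ ≤ psi (Real.exp v) * Real.exp (-u) := by gcongr
    _ = _ := by
      rw [h2]
      ring

lemma intervalIntegral_psi_exp_bounds {δ : ℝ} (hδ : 0 < δ) (y : ℝ) :
    δ * (psi (Real.exp y) * Real.exp (-y)) ≤
      Real.exp δ * ∫ u in y..(y + δ), psi (Real.exp u) * Real.exp (-u) ∧
    ∫ u in y..(y + δ), psi (Real.exp u) * Real.exp (-u) ≤
      Real.exp δ * (δ * (psi (Real.exp (y + δ)) * Real.exp (-(y + δ)))) := by
  have hi := intervalIntegrable_psi_exp y (y + δ)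
  constructor
  · rw [← intervalIntegral.integral_const_mul]
    have := intervalIntegral.integral_mono_on (a := y) (b := y + δ) (by linarith)
      (intervalIntegrable_const (c := psi (Real.exp y) * Real.exp (-y))) (hi.const_mul (Real.exp δ))
      fun u hu ↦ (psi_exp_mul_exp_neg_le hu.1).trans
        (mul_le_mul_of_nonneg_right (Real.exp_le_exp.2 (by linarith [hu.2]))
          (psi_exp_mul_exp_neg_mem_Icc u).1)
    rwa [intervalIntegral.integral_const, add_sub_cancel_left, smul_eq_mul] at this
  · have := intervalIntegral.integral_mono_on (a := y) (b := y + δ) (by linarith) hi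
      (intervalIntegrable_const
        (c := Real.exp δ * (psi (Real.exp (y + δ)) * Real.exp (-(y + δ)))))
      fun u hu ↦ (psi_exp_mul_exp_neg_le hu.2).trans
        (mul_le_mul_of_nonneg_right (Real.exp_le_exp.2 (by linarith [hu.1]))
          (psi_exp_mul_exp_neg_mem_Icc (y + δ)).1)
    refine this.trans_eq ?_
    simp
    ring

lemma tendsto_psi_exp_mul_exp_neg :
    Tendsto (fun y ↦ psi (Real.exp y) * Real.exp (-y)) atTop (𝓝 1) := by
  rw [tendsto_order]
  constructor
  · intro a ha
    obtain ⟨δ, hδ, hδa⟩ : ∃ δ : ℝ, 0 < δ ∧ a < Real.exp (-δ) := by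
      have : Tendsto (fun δ : ℝ ↦ Real.exp (-δ)) (𝓝[>] 0) (𝓝 1) := by
        have hc : Continuous fun δ : ℝ ↦ Real.exp (-δ) := by fun_prop
        simpa using (hc.tendsto 0).mono_left nhdsWithin_le_nhds
      obtain ⟨δ, h1, h2⟩ := ((this.eventually_const_lt ha).and self_mem_nhdsWithin).exists
      exact ⟨δ, h2, h1⟩
    have hlim := ((tendsto_intervalIntegral_psi_exp hδ).comp
      (tendsto_atTop_add_const_right atTop (-δ) tendsto_id)).const_mul (Real.exp (-δ) / δ)
    rw [div_mul_cancel₀ _ hδ.ne'] at hlim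
    filter_upwards [hlim.eventually_const_lt hδa] with y hy
    refine hy.trans_le ?_
    have h := (intervalIntegral_psi_exp_bounds hδ (y + -δ)).2
    simp only [Function.comp_apply, id, neg_add_cancel_right] at h ⊢
    calc
      _ ≤ Real.exp (-δ) / δ * (Real.exp δ * (δ * (psi (Real.exp y) * Real.exp (-y)))) := by gcongr
      _ = _ := by
        rw [Real.exp_neg δ]
        field_simp
  · intro a ha
    obtain ⟨δ, hδ, hδa⟩ : ∃ δ : ℝ, 0 < δ ∧ Real.exp δ < a := by
      have : Tendsto (fun δ : ℝ ↦ Real.exp δ) (𝓝[>] 0) (𝓝 1) := by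
        simpa using (Real.continuous_exp.tendsto 0).mono_left nhdsWithin_le_nhds
      obtain ⟨δ, h1, h2⟩ := ((this.eventually_lt_const ha).and self_mem_nhdsWithin).exists
      exact ⟨δ, h2, h1⟩
    have hlim := (tendsto_intervalIntegral_psi_exp hδ).const_mul (Real.exp δ / δ)
    rw [div_mul_cancel₀ _ hδ.ne'] at hlim
    filter_upwards [hlim.eventually_lt_const hδa] with y hy
    refine lt_of_le_of_lt ?_ hy
    have h := (intervalIntegral_psi_exp_bounds hδ y).1
    rw [div_mul_eq_mul_div, le_div_iff₀ hδ]
    linarith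

end VonMangoldt

/-- The prime number theorem in the form `ψ(x) ~ x`. -/
theorem pnt_psi :
    Tendsto (fun x : ℝ => (∑ n ∈ Finset.Icc 1 ⌊x⌋₊, Λ n) / x) atTop (nhds 1) := by
  refine (tendsto_psi_exp_mul_exp_neg.comp Real.tendsto_log_atTop).congr' ?_
  filter_upwards [eventually_gt_atTop 0] with x hx
  rw [Function.comp_apply, Real.exp_neg, Real.exp_log hx, ← div_eq_mul_inv]
  rfl
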